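/- arXiv:2003.02336 — 6 statements merged into one kernel-verified Lean document; each statement's English description precedes it below -/
import Mathlib

section
/- Let w be a string of length n ≥ 1 that admits a valid macro scheme with boundary positions 0 = b_0 < b_1 < ... < b_k = n such that for every 1 ≤ j ≤ k-1 the substring w[b_{j-1}, b_{j+1}) (the concatenation of the j-th and (j+1)-th phrases) occurs in w at exactly one position (namely b_{j-1}). Then every valid macro scheme of w has at least ⌈k/2⌉ phrases; in particular, k ≤ 2·b(w), where b(w) denotes the minimum number of phrases over all valid macro schemes of w. (Hence any such configuration is a 2-approximation to the optimal macro scheme.) -/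
/-- A macro scheme of a string `w : Fin n → α`: boundary positions
`0 = b 0 < b 1 < ... < b k = n` partitioning `w` into `k` phrases (the `j`-th
phrase occupying positions `[b (j-1), b j)`), together with source pointers
`p j` for phrases of length at least `2`, and the induced source map `phi`,
which sends each non-explicit position `b (j-1) + t` (for
`t < b j - b (j-1) - 1`) to `p j + t` and fixes each explicit position
`b j - 1` (the last position of each phrase). -/
structure MacroScheme {α : Type*} {n : ℕ} (w : Fin n → α) where
  k : ℕ
  b : ℕ → ℕ
  p : ℕ → ℕ
  phi : Fin n → Fin n
  b_zero : b 0 = 0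
  b_last : b k = n
  b_mono : ∀ j, j < k → b j < b (j + 1)
  p_bound : ∀ j, 1 ≤ j → j ≤ k → 2 ≤ b j - b (j - 1) →
    p j + (b j - b (j - 1) - 1) ≤ n
  copy : ∀ j, 1 ≤ j → j ≤ k → ∀ t, t < b j - b (j - 1) - 1 →
    ∀ (h1 : b (j - 1) + t < n) (h2 : p j + t < n),
      w ⟨b (j - 1) + t, h1⟩ = w ⟨p j + t, h2⟩
  phi_copy : ∀ j, 1 ≤ j → j ≤ k → ∀ t, t < b j - b (j - 1) - 1 →
    ∀ (h1 : b (j - 1) + t < n), (phi ⟨b (j - 1) + t, h1⟩ : ℕ) = p j + t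
  phi_fix : ∀ j, 1 ≤ j → j ≤ k → ∀ (h : b j - 1 < n),
    phi ⟨b j - 1, h⟩ = ⟨b j - 1, h⟩

/-- A position is explicit if it is the last position `b j - 1` of some phrase. -/
def MacroScheme.Explicit {α : Type*} {n : ℕ} {w : Fin n → α}
    (M : MacroScheme w) (i : Fin n) : Prop :=
  ∃ j, 1 ≤ j ∧ j ≤ M.k ∧ (i : ℕ) = M.b j - 1

/-- A macro scheme is valid if from every position some iterate of the source
map reaches an explicit position. -/
def MacroScheme.Valid {α : Type*} {n : ℕ} {w : Fin n → α}
    (M : MacroScheme w) : Prop :=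
  ∀ i : Fin n, ∃ m : ℕ, M.Explicit (M.phi^[m] i)

/-- The substrings `w[i, i+ℓ)` and `w[i', i'+ℓ)` are both in range and equal. -/
def MatchAt {α : Type*} {n : ℕ} (w : Fin n → α) (i i' ℓ : ℕ) : Prop :=
  i + ℓ ≤ n ∧ i' + ℓ ≤ n ∧
    ∀ t, t < ℓ → ∀ (h1 : i + t < n) (h2 : i' + t < n),
      w ⟨i + t, h1⟩ = w ⟨i' + t, h2⟩

/-- The substring `w[i, i+ℓ)` occurs in `w` at exactly one position, namely `i`. -/
def UniqueSubstring {α : Type*} {n : ℕ} (w : Fin n → α) (i ℓ : ℕ) : Prop :=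
  i + ℓ ≤ n ∧ ∀ i', MatchAt w i i' ℓ → i' = i

/-- `Γ` is a string attractor of `w`: every nonempty substring of `w` has a
copy containing a position of `Γ`. -/
def IsAttractor {α : Type*} {n : ℕ} (w : Fin n → α) (Γ : Set (Fin n)) : Prop :=
  ∀ i ℓ : ℕ, 1 ≤ ℓ → i + ℓ ≤ n →
    ∃ i', i' + ℓ ≤ n ∧
      (∀ t, t < ℓ → ∀ (h1 : i' + t < n) (h2 : i + t < n),
        w ⟨i' + t, h1⟩ = w ⟨i + t, h2⟩) ∧
      ∃ γ ∈ Γ, i' ≤ (γ : ℕ) ∧ (γ : ℕ) < i' + ℓ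

theorem MacroScheme.b_lt {α : Type*} {n : ℕ} {w : Fin n → α} (M : MacroScheme w)
    (i j : ℕ) (hij : i < j) (hj : j ≤ M.k) : M.b i < M.b j := by
  induction j, hij using Nat.le_induction with
  | base => exact M.b_mono i (by omega)
  | succ j hij ih => exact (ih (by omega)).trans (M.b_mono j (by omega))

theorem MacroScheme.b_le {α : Type*} {n : ℕ} {w : Fin n → α} (M : MacroScheme w)
    (i j : ℕ) (hij : i ≤ j) (hj : j ≤ M.k) : M.b i ≤ M.b j := by
  rcases hij.eq_or_lt with h | h
  · rw [h]
  · exact (M.b_lt i j h hj).le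

theorem MacroScheme.exists_phrase {α : Type*} {n : ℕ} {w : Fin n → α} (M : MacroScheme w)
    (a : ℕ) : ∀ q, q ≤ M.k → a < M.b q → ∃ m, m < M.k ∧ M.b m ≤ a ∧ a < M.b (m + 1) := by
  intro q
  induction q with
  | zero => intro _ h; rw [M.b_zero] at h; omega
  | succ q ih =>
    intro hq h
    by_cases h' : a < M.b q
    · exact ih (by omega) h'
    · exact ⟨q, by omega, by omega, h⟩

/-- A unique substring contains an explicit position of every valid macro scheme. -/
theorem MacroScheme.exists_explicit {α : Type*} {n : ℕ} {w : Fin n → α} (M : MacroScheme w)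
    (hM : M.Valid) (a c : ℕ) (hac : a < c) (hu : UniqueSubstring w a (c - a)) :
    ∃ m, 1 ≤ m ∧ m ≤ M.k ∧ a < M.b m ∧ M.b m ≤ c := by
  obtain ⟨hr, hu⟩ := hu
  obtain ⟨m, hm, h1, h2⟩ := M.exists_phrase a M.k le_rfl (by rw [M.b_last]; omega)
  by_cases hc : M.b (m + 1) ≤ c
  · exact ⟨m + 1, by omega, by omega, h2, hc⟩
  exfalso
  have han : a < n := by omega
  have key : ∀ s, s < c - a → ∀ (h : a + s < n),
      (M.phi ⟨a + s, h⟩ : ℕ) = M.p (m + 1) + (a - M.b m) + s := by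
    intro s hs h
    have := M.phi_copy (m + 1) (by omega) (by omega) (a - M.b m + s)
      (by simp only [Nat.add_sub_cancel]; omega) (by simp only [Nat.add_sub_cancel]; omega)
    simp only [Nat.add_sub_cancel] at this
    have e : M.b m + (a - M.b m + s) = a + s := by omega
    simp only [e] at this
    omega
  have hp : M.p (m + 1) + (a - M.b m) = a := by
    apply hu
    refine ⟨hr, ?_, ?_⟩
    · have := key (c - a - 1) (by omega) (by omega)
      have h3 := (M.phi ⟨a + (c - a - 1), by omega⟩).2
      omega
    · intro t ht h3 h4
      have := M.copy (m + 1) (by omega) (by omega) (a - M.b m + t)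
        (by simp only [Nat.add_sub_cancel]; omega) (by simp only [Nat.add_sub_cancel]; omega)
        (by omega)
      simp only [Nat.add_sub_cancel] at this
      have e : M.b m + (a - M.b m + t) = a + t := by omega
      simp only [e, ← Nat.add_assoc] at this
      exact this
  have hfix : M.phi ⟨a, han⟩ = ⟨a, han⟩ := by
    have := key 0 (by omega) (by omega)
    apply Fin.ext
    simp only [Nat.add_zero] at this
    exact this.trans hp
  obtain ⟨r, j, hj1, hj2, hj⟩ := hM ⟨a, han⟩
  rw [Function.iterate_fixed hfix] at hj
  simp only at hj
  have hpos := M.b_lt 0 j (by omega) hj2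
  rcases Nat.lt_or_ge m j with h | h
  · have := M.b_le (m + 1) j h hj2
    omega
  · have := M.b_le j m h (by omega)
    omega

/-- If `w` (of length `n ≥ 1`) admits a valid macro scheme with `k` phrases in
which the concatenation of every two consecutive phrases is a unique substring
of `w`, then every valid macro scheme of `w` has at least `⌈k/2⌉` phrases; in
particular `k ≤ 2 * b(w)`. -/
theorem two_approximation {α : Type*} {n : ℕ} (hn : 1 ≤ n) (w : Fin n → α)
    (M : MacroScheme w) (hM : M.Valid)
    (huniq : ∀ j, 1 ≤ j → j + 1 ≤ M.k →
      UniqueSubstring w (M.b (j - 1)) (M.b (j + 1) - M.b (j - 1)))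
    (M' : MacroScheme w) (hM' : M'.Valid) :
    (M.k + 1) / 2 ≤ M'.k ∧ M.k ≤ 2 * M'.k := by
  have key : ∀ i, i < (M.k + 1) / 2 → ∃ m, 1 ≤ m ∧ m ≤ M'.k ∧ M.b (2 * i) < M'.b m ∧
      M'.b m ≤ M.b (min (2 * i + 2) M.k) := by
    intro i hi
    by_cases h : 2 * i + 2 ≤ M.k
    · rw [min_eq_left h]
      have hu := huniq (2 * i + 1) (by omega) (by omega)
      exact M'.exists_explicit hM' _ _ (M.b_lt _ _ (by omega) h) hu
    · rw [min_eq_right (by omega)]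
      have h1 := M.b_lt (2 * i) M.k (by omega) le_rfl
      have h2 := M.b_last
      have h3 := M'.b_last
      refine ⟨M'.k, ?_, le_rfl, by omega, by omega⟩
      by_contra h4
      have h5 : M'.k = 0 := by omega
      rw [h5, M'.b_zero] at h3
      omega
  have main : (M.k + 1) / 2 ≤ M'.k := by
    choose! f hf1 hf2 hf3 hf4 using key
    have hlt : ∀ i j, i < j → j < (M.k + 1) / 2 → f i ≠ f j := by
      intro i j hij hj he
      have h1 := hf4 i (by omega)
      have h2 := hf3 j hj
      have h3 := M.b_le (min (2 * i + 2) M.k) (2 * j) (by omega) (by omega)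
      rw [he] at h1
      omega
    have := Finset.card_le_card_of_injOn (s := Finset.range ((M.k + 1) / 2))
      (t := Finset.Icc 1 M'.k) f
      (by
        intro i hi
        have hi' : i < (M.k + 1) / 2 := by simpa using hi
        simpa using ⟨hf1 i hi', hf2 i hi'⟩)
      (by
        intro i hi j hj he
        have hi' : i < (M.k + 1) / 2 := by simpa using hi
        have hj' : j < (M.k + 1) / 2 := by simpa using hj
        rcases lt_trichotomy i j with h | h | h
        · exact absurd he (hlt i j h hj')
        · exact h
        · exact absurd he.symm (hlt j i h hi'))
    simpa using this
  exact ⟨main, by omega⟩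
end

section
/- For any valid macro scheme of a string w of length n ≥ 1 with boundary positions 0 = b_0 < b_1 < ... < b_k = n, the set {b_1 - 1, b_2 - 1, ..., b_k - 1} of explicit positions (the last position of each phrase) is a string attractor of w. -/
theorem explicit_attractor_aux {α : Type*} {n : ℕ}
    (w : Fin n → α) (M : MacroScheme w) (ℓ : ℕ) (hℓ : 1 ≤ ℓ) (m : ℕ) :
    ∀ (i : ℕ) (hi : i < n), i + ℓ ≤ n → M.Explicit (M.phi^[m] ⟨i, hi⟩) →
    ∃ i', i' + ℓ ≤ n ∧
      (∀ t, t < ℓ → ∀ (h1 : i' + t < n) (h2 : i + t < n),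
        w ⟨i' + t, h1⟩ = w ⟨i + t, h2⟩) ∧
      ∃ γ ∈ {i : Fin n | M.Explicit i}, i' ≤ (γ : ℕ) ∧ (γ : ℕ) < i' + ℓ := by
  induction m with
  | zero =>
    intro i hi hil hE
    exact ⟨i, hil, fun _ _ _ _ => rfl, ⟨i, hi⟩, hE, le_refl _, by simp; omega⟩
  | succ m ih =>
    intro i hi hil hE
    classical
    have hex : ∃ j, i < M.b j := ⟨M.k, by rw [M.b_last]; exact hi⟩
    obtain ⟨j, hj, hmin⟩ : ∃ j, i < M.b j ∧ ∀ j' < j, ¬ i < M.b j' :=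
      ⟨Nat.find hex, Nat.find_spec hex, fun j' h => Nat.find_min hex h⟩
    have hj1 : 1 ≤ j := by
      rcases Nat.eq_zero_or_pos j with h | h
      · rw [h, M.b_zero] at hj
        omega
      · exact h
    have hjk : j ≤ M.k := by
      by_contra h
      exact hmin M.k (by omega) (by rw [M.b_last]; exact hi)
    have hlow : M.b (j - 1) ≤ i := by
      have := hmin (j - 1) (by omega)
      omega
    by_cases hc : M.b j ≤ i + ℓ
    · exact ⟨i, hil, fun _ _ _ _ => rfl, ⟨M.b j - 1, by omega⟩, ⟨j, hj1, hjk, rfl⟩,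
        by simp; omega, by simp; omega⟩
    · obtain ⟨s, rfl⟩ := Nat.exists_eq_add_of_le hlow
      have hpb := M.p_bound j hj1 hjk (by omega)
      have hphi : M.phi ⟨M.b (j - 1) + s, hi⟩ = ⟨M.p j + s, by omega⟩ :=
        Fin.ext (M.phi_copy j hj1 hjk s (by omega) hi)
      rw [Function.iterate_succ_apply, hphi] at hE
      obtain ⟨i', h1, h2, h3⟩ := ih (M.p j + s) (by omega) (by omega) hE
      refine ⟨i', h1, ?_, h3⟩
      intro t ht ha hb
      rw [h2 t ht ha (by omega)]
      have := M.copy j hj1 hjk (s + t) (by omega) (by omega) (by omega)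
      simp only [← add_assoc] at this
      exact this.symm

/-- For any valid macro scheme of a string `w` of length `n ≥ 1`, the set of
explicit positions (the last position of each phrase) is a string attractor
of `w`. -/
theorem explicit_positions_attractor {α : Type*} {n : ℕ} (hn : 1 ≤ n)
    (w : Fin n → α) (M : MacroScheme w) (hM : M.Valid) :
    IsAttractor w {i : Fin n | M.Explicit i} := by
  intro i ℓ hℓ hil
  obtain ⟨m, hm⟩ := hM ⟨i, by omega⟩
  exact explicit_attractor_aux w M ℓ hℓ m i (by omega) hil hm
end

section
/- Let w be a string of length n ≥ 1 and suppose the substring w[i, i+ℓ) (with ℓ ≥ 1 and i + ℓ ≤ n) occurs in w at exactly one position. Then for every valid macro scheme of w with boundary positions 0 = b_0 < b_1 < ... < b_k = n, there is some explicit position b_j - 1 with i ≤ b_j - 1 < i + ℓ; that is, a unique substring of w cannot lie strictly inside the copied part of a phrase of any valid macro scheme. -/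
/-- A unique substring `w[i, i+ℓ)` of `w` (length `n ≥ 1`) must contain an
explicit position `b j - 1` of every valid macro scheme of `w`. -/
theorem unique_substring_contains_explicit {α : Type*} {n : ℕ} (hn : 1 ≤ n)
    (w : Fin n → α) (i ℓ : ℕ) (hℓ : 1 ≤ ℓ) (hu : UniqueSubstring w i ℓ)
    (M : MacroScheme w) (hM : M.Valid) :
    ∃ j, 1 ≤ j ∧ j ≤ M.k ∧ i ≤ M.b j - 1 ∧ M.b j - 1 < i + ℓ := by
  classical
  obtain ⟨hin, huniq⟩ := hu
  by_contra hcon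
  push Not at hcon
  have hex : ∃ j, i < M.b j := ⟨M.k, by rw [M.b_last]; omega⟩
  obtain ⟨j, hj, hmin⟩ : ∃ j, i < M.b j ∧ ∀ m, m < j → ¬ i < M.b m :=
    ⟨Nat.find hex, Nat.find_spec hex, fun m hm => Nat.find_min hex hm⟩
  have hj1 : 1 ≤ j := by
    rcases Nat.eq_zero_or_pos j with h | h
    · subst h
      rw [M.b_zero] at hj
      omega
    · exact h
  have hjk : j ≤ M.k := by
    by_contra h
    exact hmin M.k (by omega) (by rw [M.b_last]; omega)
  have hprev : M.b (j - 1) ≤ i := by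
    have := hmin (j - 1) (by omega)
    omega
  have hend := hcon j hj1 hjk (by omega)
  have hpb := M.p_bound j hj1 hjk (by omega)
  obtain ⟨t, rfl⟩ := Nat.exists_eq_add_of_le hprev
  have hp : M.p j + t = M.b (j - 1) + t := by
    apply huniq
    refine ⟨hin, by omega, ?_⟩
    intro s hs h1 h2
    have := M.copy j hj1 hjk (t + s) (by omega) (by omega) (by omega)
    simpa only [Nat.add_assoc] using this
  have hlt : M.b (j - 1) + t < n := by omega
  have hfix : M.phi ⟨M.b (j - 1) + t, hlt⟩ = ⟨M.b (j - 1) + t, hlt⟩ := by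
    apply Fin.ext
    rw [M.phi_copy j hj1 hjk t (by omega) hlt]
    exact hp
  obtain ⟨m, j', h1, h2, h3⟩ := hM ⟨M.b (j - 1) + t, hlt⟩
  rw [Function.iterate_fixed hfix m] at h3
  have h3' : M.b (j - 1) + t = M.b j' - 1 := h3
  have := hcon j' h1 h2 (by omega)
  omega
end

section
/- Let w be a string of length n ≥ 1 and suppose there are k intervals [i_1, i_1+ℓ_1), ..., [i_k, i_k+ℓ_k) ⊆ [0, n), pairwise disjoint, each of length ℓ_r ≥ 1, such that each substring w[i_r, i_r+ℓ_r) occurs in w at exactly one position. Then every string attractor of w has at least k elements; in particular γ(w) ≥ k, where γ(w) is the minimum size of a string attractor of w. -/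
/-- If `w` (of length `n ≥ 1`) contains `k` pairwise disjoint unique
substrings, then every string attractor of `w` has at least `k` elements;
in particular `γ(w) ≥ k`. -/
theorem attractor_lower_bound {α : Type*} {n : ℕ} (hn : 1 ≤ n)
    (w : Fin n → α) (k : ℕ) (i ℓ : Fin k → ℕ)
    (hlen : ∀ r, 1 ≤ ℓ r) (hin : ∀ r, i r + ℓ r ≤ n)
    (hdisj : ∀ r s, r ≠ s → i r + ℓ r ≤ i s ∨ i s + ℓ s ≤ i r)
    (huniq : ∀ r, UniqueSubstring w (i r) (ℓ r))
    (Γ : Set (Fin n)) (hΓ : IsAttractor w Γ) :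
    k ≤ Γ.ncard := by
  have key : ∀ r, ∃ γ ∈ Γ, i r ≤ (γ : ℕ) ∧ (γ : ℕ) < i r + ℓ r := by
    intro r
    obtain ⟨i', h1, h2, γ, hγ, h3, h4⟩ := hΓ (i r) (ℓ r) (hlen r) (hin r)
    have he : i' = i r :=
      (huniq r).2 i' ⟨hin r, h1, fun t ht a b => (h2 t ht b a).symm⟩
    subst he
    exact ⟨γ, hγ, h3, h4⟩
  choose g hg h1 h2 using key
  have hinj : Function.Injective g := by
    intro r s hrs
    by_contra hne
    have a1 := h1 r
    have a2 := h2 r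
    have b1 := h1 s
    have b2 := h2 s
    rw [hrs] at a1 a2
    rcases hdisj r s hne with h | h <;> omega
  have hsub : Set.range g ⊆ Γ := by
    rintro _ ⟨r, rfl⟩
    exact hg r
  calc k = (Set.range g).ncard := by
        rw [← Set.image_univ, Set.ncard_image_of_injective _ hinj, Set.ncard_univ, Nat.card_fin]
    _ ≤ Γ.ncard := Set.ncard_le_ncard hsub (Set.toFinite Γ)
end

section
/- Let w be a string of length n ≥ 1 and suppose there are k intervals [i_1, i_1+ℓ_1), ..., [i_k, i_k+ℓ_k) ⊆ [0, n), pairwise disjoint, each of length ℓ_r ≥ 1, such that each substring w[i_r, i_r+ℓ_r) occurs in w at exactly one position. Then every valid macro scheme of w has at least k phrases. -/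
/-- If `w` (of length `n ≥ 1`) contains `k` pairwise disjoint unique
substrings, then every valid macro scheme of `w` has at least `k` phrases. -/
theorem macro_scheme_lower_bound {α : Type*} {n : ℕ} (hn : 1 ≤ n)
    (w : Fin n → α) (k : ℕ) (i ℓ : Fin k → ℕ)
    (hlen : ∀ r, 1 ≤ ℓ r) (hin : ∀ r, i r + ℓ r ≤ n)
    (hdisj : ∀ r s, r ≠ s → i r + ℓ r ≤ i s ∨ i s + ℓ s ≤ i r)
    (huniq : ∀ r, UniqueSubstring w (i r) (ℓ r))
    (M : MacroScheme w) (hM : M.Valid) :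
    k ≤ M.k := by
  have key : ∀ r : Fin k, ∃ j, 1 ≤ j ∧ j ≤ M.k ∧ i r ≤ M.b j - 1 ∧ M.b j - 1 < i r + ℓ r := by
    intro r
    by_contra hcon
    push Not at hcon
    have hl := hlen r
    have hi := hin r
    have hex : ∃ j, i r < M.b j := ⟨M.k, by rw [M.b_last]; omega⟩
    classical
    obtain ⟨j, hj, hmin⟩ : ∃ j, i r < M.b j ∧ ∀ m, m < j → ¬ i r < M.b m :=
      ⟨Nat.find hex, Nat.find_spec hex, fun m hm => Nat.find_min hex hm⟩
    have hjk : j ≤ M.k := by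
      by_contra h
      exact hmin M.k (by omega) (by rw [M.b_last]; omega)
    have hj1 : 1 ≤ j := by
      rcases Nat.eq_zero_or_pos j with h | h
      · subst h
        rw [M.b_zero] at hj
        omega
      · exact h
    have hprev := hmin (j - 1) (by omega)
    have hend := hcon j hj1 hjk (by omega)
    have hpb := M.p_bound j hj1 hjk (by omega)
    obtain ⟨d, hd⟩ : ∃ d, i r = M.b (j - 1) + d := ⟨i r - M.b (j - 1), by omega⟩
    have hm : MatchAt w (i r) (M.p j + d) (ℓ r) := by
      refine ⟨hi, by omega, ?_⟩
      intro t ht h1 h2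
      have := M.copy j hj1 hjk (d + t) (by omega) (by omega) (by omega)
      simpa only [hd, Nat.add_assoc] using this
    have hfix := (huniq r).2 _ hm
    have hlt : i r < n := by omega
    have hphi : M.phi ⟨i r, hlt⟩ = ⟨i r, hlt⟩ := by
      apply Fin.ext
      have := M.phi_copy j hj1 hjk d (by omega) (by omega)
      simp only [← hd] at this
      rw [this]
      exact hfix
    obtain ⟨m, j', h1, h2, h3⟩ := hM ⟨i r, hlt⟩
    rw [Function.iterate_fixed hphi] at h3
    simp only at h3
    have := hcon j' h1 h2 (by omega)
    omega
  choose f hf1 hfk hlo hhi using key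
  have hinj : Set.InjOn f (Finset.univ : Finset (Fin k)) := by
    intro r _ s _ h
    by_contra hne
    have a1 := hlo r
    have a2 := hhi r
    have a3 := hlo s
    have a4 := hhi s
    rw [h] at a1 a2
    rcases hdisj r s hne with h | h <;> omega
  have := Finset.card_le_card_of_injOn (s := Finset.univ) (t := Finset.Icc 1 M.k) f
    (fun r _ => by simp [hf1 r, hfk r]) hinj
  simpa using this
end

section
/- Every valid macro scheme of a string w of length n ≥ 1 has at least as many phrases as the number of distinct symbols occurring in w, i.e., k ≥ |{w(i) : i ∈ Fin n}|; consequently, a string over an alphabet of d distinct occurring symbols that admits a valid macro scheme with exactly d phrases has an optimal (minimum-size) macro scheme of size d. -/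
theorem MacroScheme.w_phi {α : Type*} {n : ℕ} {w : Fin n → α}
    (M : MacroScheme w) (i : Fin n) : w (M.phi i) = w i := by
  classical
  have hex : ∃ j, (i : ℕ) < M.b j := ⟨M.k, by rw [M.b_last]; exact i.2⟩
  obtain ⟨j, hj, hmin⟩ : ∃ j, (i : ℕ) < M.b j ∧ ∀ m, m < j → ¬ (i : ℕ) < M.b m :=
    ⟨Nat.find hex, Nat.find_spec hex, fun m hm => Nat.find_min hex hm⟩
  have hjk : j ≤ M.k := by
    by_contra hc
    exact hmin M.k (by omega) (by rw [M.b_last]; exact i.2)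
  have hj1 : 1 ≤ j := by
    rcases Nat.eq_zero_or_pos j with h0 | h0
    · subst h0
      rw [M.b_zero] at hj
      omega
    · exact h0
  have hprev : M.b (j - 1) ≤ i := not_lt.mp (hmin (j - 1) (by omega))
  by_cases hlast : (i : ℕ) = M.b j - 1
  · have hlt : M.b j - 1 < n := by rw [← hlast]; exact i.2
    have hi : i = ⟨M.b j - 1, hlt⟩ := Fin.ext hlast
    rw [hi, M.phi_fix j hj1 hjk hlt]
  · obtain ⟨t, ht⟩ : ∃ t, (i : ℕ) = M.b (j - 1) + t := ⟨i - M.b (j - 1), by omega⟩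
    have h1 : M.b (j - 1) + t < n := by rw [← ht]; exact i.2
    have htl : t < M.b j - M.b (j - 1) - 1 := by omega
    have hi : i = ⟨M.b (j - 1) + t, h1⟩ := Fin.ext ht
    have hphi := M.phi_copy j hj1 hjk t htl h1
    have h2 : M.p j + t < n := by rw [← hphi]; exact Fin.isLt _
    rw [hi, M.copy j hj1 hjk t htl h1 h2]
    exact congrArg w (Fin.ext hphi)

theorem MacroScheme.w_phi_iter {α : Type*} {n : ℕ} {w : Fin n → α}
    (M : MacroScheme w) (m : ℕ) (i : Fin n) : w (M.phi^[m] i) = w i := by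
  induction m with
  | zero => rfl
  | succ m ih => rw [Function.iterate_succ_apply', M.w_phi, ih]

theorem MacroScheme.ncard_le {α : Type*} {n : ℕ} (hn : 1 ≤ n) {w : Fin n → α}
    (M : MacroScheme w) (hM : M.Valid) : (Set.range w).ncard ≤ M.k := by
  let g : ℕ → α := fun j => if h : M.b (j + 1) - 1 < n then w ⟨_, h⟩ else w ⟨0, hn⟩
  have hsub : Set.range w ⊆ g '' (Finset.range M.k : Set ℕ) := by
    rintro _ ⟨i, rfl⟩
    obtain ⟨m, j, hj1, hjk, hj⟩ := hM i
    refine ⟨j - 1, by simp; omega, ?_⟩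
    have hjj : j - 1 + 1 = j := by omega
    have hlt : M.b j - 1 < n := by rw [← hj]; exact Fin.isLt _
    simp only [g, hjj, hlt, dite_true]
    rw [← M.w_phi_iter m i]
    exact congrArg w (Fin.ext hj.symm)
  calc (Set.range w).ncard ≤ (g '' (Finset.range M.k : Set ℕ)).ncard :=
        Set.ncard_le_ncard hsub ((Finset.finite_toSet _).image g)
    _ ≤ (Finset.range M.k : Set ℕ).ncard := Set.ncard_image_le (Finset.finite_toSet _)
    _ = M.k := by rw [Set.ncard_coe_finset, Finset.card_range]

/-- Every valid macro scheme of a string `w` of length `n ≥ 1` has at least as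
many phrases as the number of distinct symbols occurring in `w`; consequently,
if `w` admits a valid macro scheme with exactly that many phrases, this scheme
is of optimal (minimum) size. -/
theorem macro_scheme_ge_alphabet {α : Type*} {n : ℕ} (hn : 1 ≤ n)
    (w : Fin n → α) (M : MacroScheme w) (hM : M.Valid) :
    (Set.range w).ncard ≤ M.k ∧
    (M.k = (Set.range w).ncard →
      ∀ M' : MacroScheme w, M'.Valid → M.k ≤ M'.k) := by
  exact ⟨M.ncard_le hn hM, fun h M' hM' => h ▸ M'.ncard_le hn hM'⟩
end
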